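/- For every real α > −1, the series Σ_{i=1}^∞ c_i^*(α,−1) converges and equals 2·₁F₁(−α−1; 3; 2). -/

import Mathlib

open Finset

/-- Generalized binomial coefficient `C(z, k)` for real `z` and integer `k`,
equal to `z (z-1) ⋯ (z-k+1) / k!` for `k ≥ 0` and `0` for `k < 0`. -/
noncomputable def gbinom (z : ℝ) (k : ℤ) : ℝ :=
  if 0 ≤ k then (∏ j ∈ Finset.range k.toNat, (z - (j : ℝ))) / (Nat.factorial k.toNat : ℝ)
  else 0

/-- Pochhammer symbol `(z)_k = z (z+1) ⋯ (z+k-1)`. -/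
noncomputable def poch (z : ℝ) (k : ℕ) : ℝ :=
  ∏ j ∈ Finset.range k, (z + (j : ℝ))

/-- Classical Laguerre polynomial `L_n^α(x) = ∑_{k=0}^n (-1)^k C(n+α, n-k) x^k / k!`. -/
noncomputable def laguerre (α : ℝ) (n : ℕ) (x : ℝ) : ℝ :=
  ∑ k ∈ Finset.range (n + 1),
    (-1 : ℝ) ^ k * gbinom ((n : ℝ) + α) ((n : ℤ) - (k : ℤ)) * x ^ k / (Nat.factorial k : ℝ)

/-- The coefficient functions `a_i(α, x)` for `i ≥ 1`. -/
noncomputable def aFun (α : ℝ) (i : ℕ) (x : ℝ) : ℝ :=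
  (1 / (Nat.factorial i : ℝ)) * ∑ j ∈ Finset.Icc 1 i,
    (-1 : ℝ) ^ (i + j + 1) * gbinom (α + 1) ((j : ℤ) - 1) *
      gbinom (α + 2) ((i : ℤ) - (j : ℤ)) * poch (α + 3) (i - j) * x ^ j

/-- The Gauss hypergeometric series `₂F₁(a, b; c; z) = ∑_{k=0}^∞ (a)_k (b)_k z^k / ((c)_k k!)`
(used here only with `a` a nonpositive integer, so the series terminates). -/
noncomputable def hyp2F1 (a b c z : ℝ) : ℝ :=
  ∑' k : ℕ, poch a k * poch b k * z ^ k / (poch c k * (Nat.factorial k : ℝ))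

/-- The confluent hypergeometric series `₁F₁(a; b; z) = ∑_{k=0}^∞ (a)_k z^k / ((b)_k k!)`. -/
noncomputable def hyp1F1 (a b z : ℝ) : ℝ :=
  ∑' k : ℕ, poch a k * z ^ k / (poch b k * (Nat.factorial k : ℝ))

/-- `c_{2i}^*(α,x) = (4(-1)^{i+1}/(2i)!) C(α+1, i-1) ₂F₁(-i+1, α+5/2-i; 1/2; x²)` for `i ≥ 1`. -/
noncomputable def cStarEven (α : ℝ) (i : ℕ) (x : ℝ) : ℝ :=
  (4 * (-1 : ℝ) ^ (i + 1) / (Nat.factorial (2 * i) : ℝ)) * gbinom (α + 1) ((i : ℤ) - 1) *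
    hyp2F1 (-(i : ℝ) + 1) (α + 5 / 2 - (i : ℝ)) (1 / 2) (x ^ 2)

/-- `c_{2i+1}^*(α,x) = (8(-1)^{i+1}/(2i+1)!) C(α, i-1) (α+1) x ₂F₁(-i+1, α+5/2-i; 3/2; x²)`
for `i ≥ 1`. -/
noncomputable def cStarOdd (α : ℝ) (i : ℕ) (x : ℝ) : ℝ :=
  (8 * (-1 : ℝ) ^ (i + 1) / (Nat.factorial (2 * i + 1) : ℝ)) * gbinom α ((i : ℤ) - 1) *
    (α + 1) * x * hyp2F1 (-(i : ℝ) + 1) (α + 5 / 2 - (i : ℝ)) (3 / 2) (x ^ 2)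

/-- The functions `c_m^*(α,x)`: equal to `c_{2i}^*` for `m = 2i`, to `0` for `m = 1`,
and to `c_{2i+1}^*` for odd `m = 2i+1 ≥ 3`. -/
noncomputable def cS (α : ℝ) (m : ℕ) (x : ℝ) : ℝ :=
  if m = 1 then 0
  else if m % 2 = 0 then cStarEven α (m / 2) x
  else cStarOdd α (m / 2) x

theorem poch_zero (z : ℝ) : poch z 0 = 1 := by simp [poch]

theorem poch_succ (z : ℝ) (k : ℕ) : poch z (k + 1) = poch z k * (z + k) := by
  simp [poch, Finset.prod_range_succ]

theorem poch_succ_left (z : ℝ) (k : ℕ) : poch z (k + 1) = z * poch (z + 1) k := by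
  simp only [poch, Finset.prod_range_succ', Nat.cast_zero, add_zero, mul_comm z]
  congr 1
  refine Finset.prod_congr rfl fun j _ => ?_
  push_cast
  ring

theorem poch_add (z : ℝ) (m n : ℕ) : poch z (m + n) = poch z m * poch (z + m) n := by
  simp only [poch, Finset.prod_range_add]
  congr 1
  refine Finset.prod_congr rfl fun j _ => ?_
  push_cast
  ring

theorem poch_pos {z : ℝ} (hz : 0 < z) (k : ℕ) : 0 < poch z k :=
  Finset.prod_pos fun j _ => by positivity

theorem poch_neg_natCast (n k : ℕ) :
    poch (-(n : ℝ)) k = (-1) ^ k * (k.factorial : ℝ) * (n.choose k : ℝ) := by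
  induction k with
  | zero => simp [poch_zero]
  | succ k ih =>
    rw [poch_succ, ih, Nat.factorial_succ, pow_succ]
    have h : (n.choose (k + 1) : ℝ) * (k + 1) = n.choose k * (n - k) := by
      rcases le_or_gt k n with hk | hk
      · have := Nat.choose_succ_right_eq n k
        rw [← Nat.cast_sub hk]
        exact_mod_cast this
      · simp [Nat.choose_eq_zero_of_lt hk, Nat.choose_eq_zero_of_lt (Nat.lt_succ_of_lt hk)]
    push_cast
    linear_combination (-1) ^ k * (k.factorial : ℝ) * h

theorem hasSum_chu_vandermonde (n : ℕ) (b c : ℝ) (hc : 0 < c) :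
    HasSum (fun k : ℕ => (-1) ^ k * (n.choose k : ℝ) * (poch b k / poch c k))
      (poch (c - b) n / poch c n) := by
  induction n generalizing b c with
  | zero =>
    convert hasSum_single (0 : ℕ) (fun k hk => ?_) using 1
    · simp [poch_zero]
    · obtain ⟨m, rfl⟩ := Nat.exists_eq_succ_of_ne_zero hk
      simp
  | succ n ih =>
    have h₁ := ih b c hc
    have h₂ := (ih (b + 1) (c + 1) (by positivity)).mul_left (-(b / c))
    have h₃ := (hasSum_nat_add_iff' 1).2 h₁
    rw [← hasSum_nat_add_iff' 1]
    convert h₃.add h₂ using 1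
    · funext k
      rw [Nat.choose_succ_succ, poch_succ_left b, poch_succ_left c]
      have := (poch_pos (z := c + 1) (by positivity) k).ne'
      push_cast
      field_simp
      ring
    · have h₄ := (poch_pos hc n).ne'
      have h₅ := (poch_pos (z := c + 1) (by positivity) n).ne'
      have h₆ : c + n ≠ 0 := by positivity
      have h₇ : poch c n * (c + n) = c * poch (c + 1) n := by
        rw [← poch_succ, poch_succ_left]
      have h₈ : poch (c + 1) n = poch c n * (c + n) / c := by
        rw [h₇]; field_simp
      rw [poch_succ, poch_succ, show c + 1 - (b + 1) = c - b by ring, h₈]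
      simp [poch_zero]
      field_simp
      ring

theorem hyp2F1_neg_natCast_one (n : ℕ) (b c : ℝ) (hc : 0 < c) :
    hyp2F1 (-(n : ℝ)) b c 1 = poch (c - b) n / poch c n := by
  rw [hyp2F1, ← (hasSum_chu_vandermonde n b c hc).tsum_eq]
  refine tsum_congr fun k => ?_
  have h₁ := (poch_pos hc k).ne'
  have h₂ : (k.factorial : ℝ) ≠ 0 := by positivity
  rw [poch_neg_natCast]
  field_simp
  simp

theorem gbinom_natCast (z : ℝ) (n : ℕ) :
    gbinom z (n : ℤ) = (-1) ^ n * poch (-z) n / (n.factorial : ℝ) := by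
  simp only [gbinom, poch, Int.natCast_nonneg, if_true, Int.toNat_natCast]
  congr 1
  rw [← Finset.card_range n, ← Finset.prod_const, Finset.card_range, ← Finset.prod_mul_distrib]
  exact Finset.prod_congr rfl fun j _ => by ring

theorem poch_one_half (n : ℕ) :
    poch (1 / 2) n * (4 ^ n * n.factorial) = ((2 * n).factorial : ℝ) := by
  induction n with
  | zero => simp [poch_zero]
  | succ n ih =>
    rw [poch_succ, show 2 * (n + 1) = 2 * n + 1 + 1 by ring, Nat.factorial_succ,
      Nat.factorial_succ, Nat.factorial_succ, pow_succ]
    push_cast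
    rw [← ih]
    ring

theorem poch_three_halves (n : ℕ) :
    poch (3 / 2) n * (4 ^ n * n.factorial) = ((2 * n + 1).factorial : ℝ) := by
  have h := poch_one_half n
  have h' : poch (1 / 2) n * (1 / 2 + n) = 1 / 2 * poch (3 / 2) n := by
    rw [← poch_succ, poch_succ_left]
    norm_num
  rw [Nat.factorial_succ]
  push_cast
  rw [← h]
  linear_combination (-2 * (4 ^ n * (n.factorial : ℝ))) * h'

theorem poch_three (k : ℕ) : 2 * poch 3 k = ((k + 2).factorial : ℝ) := by
  induction k with
  | zero => simp [poch_zero]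
  | succ k ih =>
    rw [poch_succ, show k + 1 + 2 = (k + 2) + 1 by ring, Nat.factorial_succ]
    push_cast
    rw [← ih]
    ring

theorem cStarEven_neg_one (α : ℝ) (n : ℕ) :
    cStarEven α (n + 1) (-1) =
      2 * (poch (-α - 1) (2 * n) * 2 ^ (2 * n) / (poch 3 (2 * n) * ((2 * n).factorial : ℝ))) := by
  have h₁ := poch_three (2 * n)
  have h₂ := poch_one_half n
  have h₃ := (poch_pos (z := 1 / 2) (by norm_num) n).ne'
  have h₄ := (poch_pos (z := 3) (by norm_num) (2 * n)).ne'
  have h₅ : (n.factorial : ℝ) ≠ 0 := by positivity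
  have e : ((-1 : ℝ) ^ n) ^ 2 = 1 := by rw [← pow_mul, mul_comm, pow_mul]; simp
  rw [cStarEven, show -((n + 1 : ℕ) : ℝ) + 1 = -(n : ℝ) by push_cast; ring,
    show ((n + 1 : ℕ) : ℤ) - 1 = n by push_cast; ring, gbinom_natCast, neg_one_sq,
    hyp2F1_neg_natCast_one _ _ _ (by norm_num), show 2 * (n + 1) = 2 * n + 2 by ring, ← h₁, ← h₂,
    two_mul n, poch_add (-α - 1), ← two_mul,
    show (1 : ℝ) / 2 - (α + 5 / 2 - ((n + 1 : ℕ) : ℝ)) = -α - 1 + n by push_cast; ring,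
    show -(α + 1) = -α - 1 by ring, pow_mul, pow_succ, pow_succ]
  norm_num
  field_simp
  rw [e]
  ring

theorem cStarOdd_neg_one (α : ℝ) (n : ℕ) :
    cStarOdd α (n + 1) (-1) =
      2 * (poch (-α - 1) (2 * n + 1) * 2 ^ (2 * n + 1) /
        (poch 3 (2 * n + 1) * ((2 * n + 1).factorial : ℝ))) := by
  have h₁ := poch_three (2 * n + 1)
  have h₂ := poch_three_halves n
  have h₃ := (poch_pos (z := 3 / 2) (by norm_num) n).ne'
  have h₄ := (poch_pos (z := 3) (by norm_num) (2 * n + 1)).ne'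
  have h₅ : (n.factorial : ℝ) ≠ 0 := by positivity
  have e : ((-1 : ℝ) ^ n) ^ 2 = 1 := by rw [← pow_mul, mul_comm, pow_mul]; simp
  have h₆ : poch (-α - 1) (2 * n + 1) = (-α - 1) * (poch (-α) n * poch (-α + n) n) := by
    rw [poch_succ_left, two_mul, poch_add, sub_add_cancel]
  rw [cStarOdd, show -((n + 1 : ℕ) : ℝ) + 1 = -(n : ℝ) by push_cast; ring,
    show ((n + 1 : ℕ) : ℤ) - 1 = n by push_cast; ring, gbinom_natCast, neg_one_sq,
    hyp2F1_neg_natCast_one _ _ _ (by norm_num), show 2 * (n + 1) + 1 = 2 * n + 1 + 2 by ring,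
    ← h₁, ← h₂, h₆,
    show (3 : ℝ) / 2 - (α + 5 / 2 - ((n + 1 : ℕ) : ℝ)) = -α + n by push_cast; ring,
    pow_succ (2 : ℝ), pow_mul (2 : ℝ), pow_succ, pow_succ]
  norm_num
  field_simp
  rw [e]
  ring

theorem cS_add_two_neg_one (α : ℝ) (m : ℕ) :
    cS α (m + 2) (-1) = 2 * (poch (-α - 1) m * 2 ^ m / (poch 3 m * (m.factorial : ℝ))) := by
  rcases Nat.even_or_odd' m with ⟨n, rfl | rfl⟩
  · rw [← cStarEven_neg_one, cS, if_neg (by omega), if_pos (by omega)]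
    congr 1
    omega
  · rw [← cStarOdd_neg_one, cS, if_neg (by omega), if_neg (by omega)]
    congr 1
    omega

theorem abs_poch_le (a : ℝ) (k : ℕ) : |poch a k| ≤ (|a| + 1) ^ k * k.factorial := by
  induction k with
  | zero => simp [poch_zero]
  | succ k ih =>
    have h : |a + k| ≤ (|a| + 1) * (k + 1) := by
      have h₁ := abs_add_le a k
      rw [Nat.abs_cast] at h₁
      nlinarith [mul_nonneg (abs_nonneg a) (Nat.cast_nonneg (α := ℝ) k)]
    rw [poch_succ, abs_mul, Nat.factorial_succ]
    calc |poch a k| * |a + k| ≤ ((|a| + 1) ^ k * k.factorial) * ((|a| + 1) * (k + 1)) := by gcongr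
      _ = _ := by push_cast; ring

theorem summable_hyp1F1 (a b z : ℝ) (hb : 1 ≤ b) :
    Summable fun k : ℕ => poch a k * z ^ k / (poch b k * (k.factorial : ℝ)) := by
  refine Summable.of_norm_bounded (Real.summable_pow_div_factorial ((|a| + 1) * |z|)) fun k => ?_
  have h : (k.factorial : ℝ) ≤ poch b k := by
    induction k with
    | zero => simp [poch_zero]
    | succ k ih =>
      rw [poch_succ, Nat.factorial_succ, mul_comm]
      push_cast
      exact mul_le_mul ih (by linarith) (by positivity) (poch_pos (by linarith) k).le
  have hk : (0 : ℝ) < k.factorial := by positivity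
  rw [Real.norm_eq_abs, abs_div, abs_mul, abs_pow,
    abs_of_pos (mul_pos (poch_pos (by linarith : 0 < b) k) hk)]
  calc |poch a k| * |z| ^ k / (poch b k * k.factorial)
      ≤ ((|a| + 1) ^ k * k.factorial) * |z| ^ k / (k.factorial * k.factorial) := by
        gcongr
        exact abs_poch_le a k
    _ = _ := by rw [mul_pow]; field_simp

/-- `∑_{i=1}^∞ c_i^*(α,-1) = 2 ₁F₁(-α-1; 3; 2)`. -/
theorem statement17 (α : ℝ) (hα : -1 < α) :
    HasSum (fun m : ℕ => cS α (m + 1) (-1)) (2 * hyp1F1 (-α - 1) 3 2) := by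
  rw [← hasSum_nat_add_iff' 1]
  have h := ((summable_hyp1F1 (-α - 1) 3 2 (by norm_num)).hasSum).mul_left 2
  simp only [← cS_add_two_neg_one] at h
  simpa only [Finset.sum_range_one, zero_add, cS, if_true, sub_zero, hyp1F1] using h
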